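/- Let a = (a₁,…,a₁₀) ∈ ℤ^10 with Σᵢ aᵢ = 0 and a ≠ 0. Then there exist three distinct indices i, j, k ∈ {1,…,10} such that Q(2Eᵢ − a) < 0, Q(2Eⱼ − a) < 0, and Q(2E_k − a) < 0. -/

import Mathlib

/-- The quadratic form `Q(x) = (Σᵢ xᵢ)² − Σᵢ xᵢ²` on `ℤ^10`, the intersection form
of the numerical lattice of an Enriques surface in the basis of half-pencils `Eᵢ`. -/
def Q (x : Fin 10 → ℤ) : ℤ := (∑ i, x i) ^ 2 - ∑ i, (x i) ^ 2

/-- The standard basis vector `Eᵢ` of `ℤ^10` (the half-pencil classes). -/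
def E (i : Fin 10) : Fin 10 → ℤ := fun j => if j = i then 1 else 0

/-- If `Σᵢ aᵢ = 0`, then `Q(2Eᵢ − a) = 4aᵢ − Σⱼ aⱼ²`. -/
theorem Q_two_smul_E_sub (a : Fin 10 → ℤ) (hsum : ∑ i, a i = 0) (i : Fin 10) :
    Q ((2 : ℤ) • E i - a) = 4 * a i - ∑ j, a j ^ 2 := by
  have hlin : ∑ j, ((2 : ℤ) • E i - a) j = 2 := by
    simp [E, Finset.sum_sub_distrib, hsum]
  have hsq : ∀ j, ((2 : ℤ) • E i - a) j ^ 2 =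
      (if j = i then 4 - 4 * a j else 0) + a j ^ 2 := by
    intro j
    simp only [E, Pi.sub_apply, Pi.smul_apply, smul_eq_mul]
    split_ifs <;> ring
  simp only [Q, hlin, hsq, Finset.sum_add_distrib, Finset.sum_ite_eq', Finset.mem_univ, if_true]
  ring

/-- For a nonzero integer vector, at most four coordinates satisfy `4aᵢ ≥ Σⱼ aⱼ²`. -/
theorem card_filter_sum_sq_le_four_mul {ι : Type*} [Fintype ι] (a : ι → ℤ) (ha : a ≠ 0) :
    (Finset.univ.filter fun i => ∑ j, a j ^ 2 ≤ 4 * a i).card ≤ 4 := by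
  set S := ∑ j, a j ^ 2
  set B := Finset.univ.filter fun i => S ≤ 4 * a i
  have hpos : 0 < S := by
    obtain ⟨i, hi⟩ := Function.ne_iff.mp ha
    exact Finset.sum_pos' (fun j _ => sq_nonneg (a j))
      ⟨i, Finset.mem_univ i, sq_pos_of_ne_zero hi⟩
  have hlower : B.card * S ≤ ∑ i ∈ B, 4 * a i := by
    rw [← nsmul_eq_mul]
    exact Finset.card_nsmul_le_sum B _ S fun i hi => (Finset.mem_filter.mp hi).2
  have hupper : ∑ i ∈ B, a i ≤ S :=
    (Finset.sum_le_sum fun i _ => Int.le_self_sq (a i)).trans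
      (Finset.sum_le_univ_sum_of_nonneg fun i => sq_nonneg (a i))
  rw [← Finset.mul_sum] at hlower
  have hcard : (B.card : ℤ) ≤ 4 := le_of_mul_le_mul_right (by linarith) hpos
  exact_mod_cast hcard

/-- If `a ∈ ℤ^10` has `Σᵢ aᵢ = 0` and `a ≠ 0`, then there are three distinct indices
`i, j, k` with `Q(2Eᵢ − a) < 0`, `Q(2Eⱼ − a) < 0` and `Q(2Eₖ − a) < 0`. -/
theorem exists_three_indices (a : Fin 10 → ℤ) (hsum : ∑ i, a i = 0) (ha : a ≠ 0) :
    ∃ i j k : Fin 10, i ≠ j ∧ i ≠ k ∧ j ≠ k ∧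
      Q ((2 : ℤ) • E i - a) < 0 ∧ Q ((2 : ℤ) • E j - a) < 0 ∧
      Q ((2 : ℤ) • E k - a) < 0 := by
  have hbad := card_filter_sum_sq_le_four_mul a ha
  have htotal := Finset.card_filter_add_card_filter_not (s := Finset.univ)
    (fun i => ∑ j, a j ^ 2 ≤ 4 * a i)
  rw [Finset.card_univ, Fintype.card_fin] at htotal
  obtain ⟨i, j, k, hi, hj, hk, hij, hik, hjk⟩ := Finset.two_lt_card_iff.mp
    (show 2 < (Finset.univ.filter fun i => ¬ ∑ j, a j ^ 2 ≤ 4 * a i).card by omega)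
  simp only [Finset.mem_filter, Finset.mem_univ, true_and, not_le] at hi hj hk
  simp only [Q_two_smul_E_sub a hsum, sub_neg]
  exact ⟨i, j, k, hij, hik, hjk, hi, hj, hk⟩
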